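/- Let G be a finite simple graph with vertex set V equipped with a grounded string representation: an injective function g : V → ℝ and, for each vertex v, a continuous curve f_v : [0,1] → ℝ × [0, ∞) with f_v(0) = (g(v), 0), such that no point of the x-axis belongs to the images of two distinct curves, and two distinct vertices u, v are adjacent in G if and only if the images of f_u and f_v intersect. Then the linear order of V given by g avoids the pattern P_{abcd}: there are no vertices v1, v2, v3, v4 with g(v1) < g(v2) < g(v3) < g(v4) such that v1v3 and v2v4 are edges of G while v1v2, v2v3, v3v4 and v1v4 are non-edges of G. -/

import Mathlib

open Set Complex in
/-- A continuous logarithm exists for every nowhere vanishing continuous function on the plane,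
with any prescribed value of the logarithm at one point. -/
theorem exists_continuous_log {F : ℝ × ℝ → ℂ} (hF : Continuous F) (hF0 : ∀ x, F x ≠ 0)
    {x₀ : ℝ × ℝ} {l₀ : ℂ} (hl₀ : exp l₀ = F x₀) :
    ∃ L : ℝ × ℝ → ℂ, Continuous L ∧ L x₀ = l₀ ∧ ∀ x, exp (L x) = F x := by
  obtain ⟨L, ⟨hL₀, hL⟩, -⟩ := isCoveringMapOn_exp.existsUnique_continuousMap_lifts
    (⟨F, hF⟩ : C(ℝ × ℝ, ℂ)) hl₀ hF0
  exact ⟨L, L.continuous, hL₀, fun x => congrFun hL x⟩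

open Set Real in
/-- A continuous angle that starts at `0` and keeps a nonnegative sine stays strictly between
`-π / 2` and `3 * π / 2`. -/
theorem angle_mem_Ioo_of_sin_nonneg {θ : ℝ → ℝ} (hθ : Continuous θ) (h0 : θ 0 = 0)
    (hsin : ∀ t, 0 ≤ sin (θ t)) : θ 1 ∈ Ioo (-(π / 2)) (3 * π / 2) := by
  have hπ := pi_pos
  constructor
  · by_contra! h
    obtain ⟨t, -, ht⟩ := intermediate_value_Icc' zero_le_one hθ.continuousOn
      (show -(π / 2) ∈ Icc (θ 1) (θ 0) from ⟨h, by linarith⟩)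
    have := hsin t
    rw [ht, sin_neg, sin_pi_div_two] at this
    linarith
  · by_contra! h
    obtain ⟨t, -, ht⟩ := intermediate_value_Icc zero_le_one hθ.continuousOn
      (show 3 * π / 2 ∈ Icc (θ 0) (θ 1) from ⟨by linarith, h⟩)
    have := hsin t
    rw [ht, show 3 * π / 2 = π / 2 + π by ring, sin_add_pi, sin_pi_div_two] at this
    linarith

open Real in
theorem angle_eq_zero_of_cos_pos {θ : ℝ → ℝ} (hθ : Continuous θ) (h0 : θ 0 = 0)
    (hsin : ∀ t, 0 ≤ sin (θ t)) (h1 : sin (θ 1) = 0) (hcos : 0 < cos (θ 1)) : θ 1 = 0 := by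
  obtain ⟨hl, hu⟩ := angle_mem_Ioo_of_sin_nonneg hθ h0 hsin
  have hπ := pi_pos
  have hlt : θ 1 < π / 2 := by
    by_contra! h
    exact absurd hcos (cos_nonpos_of_pi_div_two_le_of_le h (by linarith)).not_gt
  exact (sin_eq_zero_iff_of_lt_of_lt (by linarith) (by linarith)).1 h1

open Real in
theorem angle_eq_pi_of_cos_neg {θ : ℝ → ℝ} (hθ : Continuous θ) (h0 : θ 0 = 0)
    (hsin : ∀ t, 0 ≤ sin (θ t)) (h1 : sin (θ 1) = 0) (hcos : cos (θ 1) < 0) : θ 1 = π := by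
  obtain ⟨hl, hu⟩ := angle_mem_Ioo_of_sin_nonneg hθ h0 hsin
  have hπ := pi_pos
  have hlt : π / 2 < θ 1 := by
    by_contra! h
    exact absurd hcos (cos_nonneg_of_neg_pi_div_two_le_of_le (by linarith) h).not_gt
  have := (sin_eq_zero_iff_of_lt_of_lt (x := θ 1 - π) (by linarith) (by linarith)).1
    (by rw [sin_sub_pi, h1, neg_zero])
  linarith

open Complex in
/-- Two curves in the closed upper half-plane whose endpoints lie on the real axis and
interleave there have a common point. -/
theorem exists_eq_of_interleaved_endpoints {p q : ℝ → ℂ} (hp : Continuous p) (hq : Continuous q)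
    (hpim : ∀ s, 0 ≤ (p s).im) (hqim : ∀ t, 0 ≤ (q t).im) {a b c d : ℝ}
    (hp0 : p 0 = a) (hp1 : p 1 = c) (hq0 : q 0 = b) (hq1 : q 1 = d)
    (hab : a < b) (hbc : b < c) (hcd : c < d) : ∃ s t, p s = q t := by
  by_contra! hne
  obtain ⟨L, hLc, hL0, hL⟩ := exists_continuous_log (F := fun x => q x.2 - p x.1)
    (x₀ := (0, 0)) (l₀ := (Real.log (b - a) : ℂ)) (by fun_prop)
    (fun x => sub_ne_zero.2 (hne x.1 x.2).symm)
    (by rw [← ofReal_exp, Real.exp_log (sub_pos.2 hab)]; simp [hp0, hq0])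
  have him (s t : ℝ) : Real.exp (L (s, t)).re * Real.sin (L (s, t)).im = (q t).im - (p s).im := by
    rw [← exp_im, hL, sub_im]
  have hre (s t : ℝ) : Real.exp (L (s, t)).re * Real.cos (L (s, t)).im = (q t).re - (p s).re := by
    rw [← exp_re, hL, sub_re]
  have sin_nonneg {s t : ℝ} (h : (p s).im = 0) : 0 ≤ Real.sin (L (s, t)).im :=
    nonneg_of_mul_nonneg_right (by rw [him, h, sub_zero]; exact hqim t) (Real.exp_pos _)
  have sin_nonpos {s t : ℝ} (h : (q t).im = 0) : 0 ≤ Real.sin (-(L (s, t)).im) := by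
    refine nonneg_of_mul_nonneg_right (a := Real.exp (L (s, t)).re) ?_ (Real.exp_pos _)
    rw [Real.sin_neg, mul_neg, him, h, zero_sub, neg_neg]
    exact hpim s
  have sin_zero {s t : ℝ} (h : (p s).im = 0) (h' : (q t).im = 0) : Real.sin (L (s, t)).im = 0 := by
    have := him s t
    rw [h, h', sub_zero] at this
    exact (mul_eq_zero.1 this).resolve_left (Real.exp_pos _).ne'
  have cos_pos {s t : ℝ} (h : (p s).re < (q t).re) : 0 < Real.cos (L (s, t)).im :=
    pos_of_mul_pos_right (by rw [hre]; exact sub_pos.2 h) (Real.exp_pos (L (s, t)).re).le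
  have cos_neg {s t : ℝ} (h : (q t).re < (p s).re) : Real.cos (L (s, t)).im < 0 := by
    by_contra! h'
    have := mul_nonneg (Real.exp_pos (L (s, t)).re).le h'
    rw [hre] at this
    linarith
  have hp0i : (p 0).im = 0 := by simp [hp0]
  have hp1i : (p 1).im = 0 := by simp [hp1]
  have hq0i : (q 0).im = 0 := by simp [hq0]
  have hq1i : (q 1).im = 0 := by simp [hq1]
  have h00 : (L (0, 0)).im = 0 := by rw [hL0, ofReal_im]
  have h01 : (L (0, 1)).im = 0 :=
    angle_eq_zero_of_cos_pos (θ := fun t => (L (0, t)).im) (by fun_prop) h00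
      (fun t => sin_nonneg hp0i) (sin_zero hp0i hq1i)
      (cos_pos (by simp only [hp0, hq1, ofReal_re]; linarith))
  have h11 : -(L (1, 1)).im = 0 :=
    angle_eq_zero_of_cos_pos (θ := fun s => -(L (s, 1)).im) (by fun_prop) (by simp [h01])
      (fun s => sin_nonpos hq1i) (by simp [sin_zero hp1i hq1i])
      (by rw [Real.cos_neg]; exact cos_pos (by simp only [hp1, hq1, ofReal_re]; linarith))
  have h10 : -(L (1, 0)).im = Real.pi :=
    angle_eq_pi_of_cos_neg (θ := fun s => -(L (s, 0)).im) (by fun_prop) (by simp [h00])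
      (fun s => sin_nonpos hq0i) (by simp [sin_zero hp1i hq0i])
      (by rw [Real.cos_neg]; exact cos_neg (by simp only [hp1, hq0, ofReal_re]; linarith))
  have h10' : (L (1, 1 - 1)).im = Real.pi :=
    angle_eq_pi_of_cos_neg (θ := fun t => (L (1, 1 - t)).im) (by fun_prop)
      (by rw [sub_zero]; exact neg_eq_zero.1 h11)
      (fun t => sin_nonneg hp1i) (by simp [sin_zero hp1i hq0i])
      (by rw [sub_self]; exact cos_neg (by simp only [hp1, hq0, ofReal_re]; linarith))
  rw [sub_self] at h10'
  linarith [Real.pi_pos]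

open Set in
/-- Two path-connected subsets of the closed upper half-plane that contain interleaving pairs of
points of the `x`-axis intersect. -/
theorem IsPathConnected.inter_nonempty_of_interleaved {A B : Set (ℝ × ℝ)}
    (hA : IsPathConnected A) (hB : IsPathConnected B)
    (hA0 : ∀ x ∈ A, 0 ≤ x.2) (hB0 : ∀ x ∈ B, 0 ≤ x.2) {a b c d : ℝ}
    (ha : (a, 0) ∈ A) (hc : (c, 0) ∈ A) (hb : (b, 0) ∈ B) (hd : (d, 0) ∈ B)
    (hab : a < b) (hbc : b < c) (hcd : c < d) : (A ∩ B).Nonempty := by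
  obtain ⟨p, hp⟩ := hA.joinedIn _ ha _ hc
  obtain ⟨q, hq⟩ := hB.joinedIn _ hb _ hd
  have hp' (s : ℝ) : p.extend s ∈ A := hp _
  have hq' (t : ℝ) : q.extend t ∈ B := hq _
  let e := Complex.equivRealProdCLM.symm
  obtain ⟨s, t, hst⟩ := exists_eq_of_interleaved_endpoints
    (p := fun s => e (p.extend s)) (q := fun t => e (q.extend t)) (a := a) (b := b) (c := c)
    (d := d) (e.continuous.comp p.continuous_extend) (e.continuous.comp q.continuous_extend)
    (fun s => by simpa [e] using hA0 _ (hp' s)) (fun t => by simpa [e] using hB0 _ (hq' t))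
    (by simp [e, Complex.ext_iff]) (by simp [e, Complex.ext_iff])
    (by simp [e, Complex.ext_iff]) (by simp [e, Complex.ext_iff]) hab hbc hcd
  exact ⟨p.extend s, hp' s, e.injective hst ▸ hq' t⟩


/-- In a grounded string representation of a finite graph, the grounding order
avoids the pattern `P_{abcd}`. -/
theorem grounded_string_order_avoids_Pabcd
    {V : Type*} [Fintype V] (G : SimpleGraph V)
    (g : V → ℝ) (f : V → ℝ → ℝ × ℝ)
    (hg : Function.Injective g)
    (hcont : ∀ v, ContinuousOn (f v) (Set.Icc 0 1))
    (hupper : ∀ v, ∀ t ∈ Set.Icc (0 : ℝ) 1, 0 ≤ (f v t).2)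
    (h0 : ∀ v, f v 0 = (g v, 0))
    (haxis : ∀ u v, u ≠ v →
      ∀ p ∈ f u '' Set.Icc (0 : ℝ) 1 ∩ f v '' Set.Icc (0 : ℝ) 1, p.2 ≠ 0)
    (hadj : ∀ u v, u ≠ v →
      (G.Adj u v ↔ (f u '' Set.Icc (0 : ℝ) 1 ∩ f v '' Set.Icc (0 : ℝ) 1).Nonempty)) :
    ∀ v1 v2 v3 v4 : V, g v1 < g v2 → g v2 < g v3 → g v3 < g v4 →
      G.Adj v1 v3 → G.Adj v2 v4 →
      ¬G.Adj v1 v2 → ¬G.Adj v2 v3 → ¬G.Adj v3 v4 → ¬G.Adj v1 v4 → False := by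
  intro v1 v2 v3 v4 h12 h23 h34 a13 a24 n12 n23 n34 n14
  have hconn (v : V) : IsPathConnected (f v '' Set.Icc (0 : ℝ) 1) :=
    ((convex_Icc (0 : ℝ) 1).isPathConnected ⟨0, by simp⟩).image' (hcont v)
  have hpos (v : V) : ∀ x ∈ f v '' Set.Icc (0 : ℝ) 1, 0 ≤ x.2 :=
    Set.forall_mem_image.2 (hupper v)
  have hmem (v : V) : (g v, (0 : ℝ)) ∈ f v '' Set.Icc (0 : ℝ) 1 := ⟨0, by simp, h0 v⟩
  have hdisj {u v : V} (huv : g u < g v) (hn : ¬G.Adj u v) {x : ℝ × ℝ}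
      (hu : x ∈ f u '' Set.Icc (0 : ℝ) 1) (hv : x ∈ f v '' Set.Icc (0 : ℝ) 1) : False :=
    hn ((hadj u v (ne_of_apply_ne g huv.ne)).2 ⟨x, hu, hv⟩)
  obtain ⟨x, hx | hx, hx' | hx'⟩ := IsPathConnected.inter_nonempty_of_interleaved
    ((hconn v1).union (hconn v3) ((hadj v1 v3 a13.ne).1 a13))
    ((hconn v2).union (hconn v4) ((hadj v2 v4 a24.ne).1 a24))
    (fun x hx => hx.elim (hpos v1 x) (hpos v3 x)) (fun x hx => hx.elim (hpos v2 x) (hpos v4 x))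
    (.inl (hmem v1)) (.inr (hmem v3)) (.inl (hmem v2)) (.inr (hmem v4)) h12 h23 h34
  · exact hdisj h12 n12 hx hx'
  · exact hdisj (h12.trans (h23.trans h34)) n14 hx hx'
  · exact hdisj h23 n23 hx' hx
  · exact hdisj h34 n34 hx hx'
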